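/- Let p > 1 and γ, λ, μ ∈ ℝ. There exists a constant C > 0, depending only on p, such that for all measurable v, w : ℝ² → ℂ with ‖v‖_p < ∞ and ‖w‖_p < ∞, ‖L(v) − L(w)‖_p ≤ C·(|γ| + |λμ|)·(‖v‖_p + ‖w‖_p)²·‖v − w‖_p; that is, L is Lipschitz on bounded sets of the weighted space. -/

import Mathlib

open MeasureTheory Filter
open scoped ENNReal Topology

/-- The weighted norm `‖v‖_p = (∫ (1 + |k| + |m|)^(2p) |v(k,m)|² dk dm)^(1/2)` on `ℝ²`. -/
noncomputable def wnorm (p : ℝ) (v : ℝ × ℝ → ℂ) : ℝ≥0∞ :=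
  (∫⁻ km : ℝ × ℝ, ENNReal.ofReal ((1 + |km.1| + |km.2|) ^ (2 * p)) * (‖v km‖₊ : ℝ≥0∞) ^ 2) ^
    ((1 : ℝ) / 2)

/-- The convolution `(f ⋆ g)(ξ) = ∫ f (ξ - η) g η dη` over `ℝ²`. -/
noncomputable def conv (f g : ℝ × ℝ → ℂ) : ℝ × ℝ → ℂ :=
  fun ξ => ∫ η : ℝ × ℝ, f (ξ - η) * g η

/-- `v†(k,m) = conj (v (-k, -m))`, the Fourier transform of the complex conjugate. -/
def dag (v : ℝ × ℝ → ℂ) : ℝ × ℝ → ℂ :=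
  fun km => starRingEnd ℂ (v (-km))

/-- `σ(k,m) = k² / (k² + m²)` for `(k,m) ≠ 0`, and `σ(0,0) = 0`. -/
noncomputable def sigmaMul : ℝ × ℝ → ℝ :=
  fun km => if km = 0 then 0 else km.1 ^ 2 / (km.1 ^ 2 + km.2 ^ 2)

/-- The Fourier-side Davey–Stewartson-II nonlinearity
`L(v) = γ (v ⋆ v† ⋆ v) + λμ (v ⋆ (σ · (v ⋆ v†)))`. -/
noncomputable def Lop (γ lam μ : ℝ) (v : ℝ × ℝ → ℂ) : ℝ × ℝ → ℂ :=
  fun km => (γ : ℂ) * conv (conv v (dag v)) v km +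
    ((lam * μ : ℝ) : ℂ) * conv v (fun η => (sigmaMul η : ℂ) * conv v (dag v) η) km

/-- The weight `(1 + |k| + |m|)^(2p)`. -/
noncomputable def weight (p : ℝ) (x : ℝ × ℝ) : ℝ≥0∞ :=
  ENNReal.ofReal ((1 + |x.1| + |x.2|) ^ (2 * p))

/-- Measurable functions with finite weighted norm. -/
def FiniteWnorm (p : ℝ) (f : ℝ × ℝ → ℂ) : Prop :=
  Measurable f ∧ wnorm p f < ⊤

theorem one_le_weightBase (x : ℝ × ℝ) : 1 ≤ 1 + |x.1| + |x.2| := by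
  have := abs_nonneg x.1
  have := abs_nonneg x.2
  linarith

theorem measurable_weight (p : ℝ) : Measurable (weight p) := by
  unfold weight
  fun_prop

theorem one_le_weight {p : ℝ} (hp : 1 < p) (x : ℝ × ℝ) : 1 ≤ weight p x := by
  rw [weight, ENNReal.one_le_ofReal]
  exact Real.one_le_rpow (one_le_weightBase x) (by linarith)

theorem weight_ne_top (p : ℝ) (x : ℝ × ℝ) : weight p x ≠ ⊤ := ENNReal.ofReal_ne_top

theorem weight_neg (p : ℝ) (x : ℝ × ℝ) : weight p (-x) = weight p x := by
  simp [weight]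

/-- The weight is quasi-subadditive. -/
theorem weight_add_le {p : ℝ} (hp : 1 < p) (x y : ℝ × ℝ) :
    weight p (x + y) ≤ ENNReal.ofReal (2 ^ (2 * p)) * (weight p x + weight p y) := by
  have hp0 : 0 ≤ 2 * p := by linarith
  have hx := one_le_weightBase x
  have hy := one_le_weightBase y
  have hxy := one_le_weightBase (x + y)
  unfold weight
  rw [← ENNReal.ofReal_add (by positivity) (by positivity), ← ENNReal.ofReal_mul (by positivity)]
  apply ENNReal.ofReal_le_ofReal
  have h1 : 1 + |(x + y).1| + |(x + y).2| ≤ (1 + |x.1| + |x.2|) + (1 + |y.1| + |y.2|) := by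
    have := abs_add_le x.1 y.1
    have := abs_add_le x.2 y.2
    simp only [Prod.fst_add, Prod.snd_add]
    linarith
  set a := 1 + |x.1| + |x.2|
  set b := 1 + |y.1| + |y.2|
  have ha : 0 ≤ a ^ (2 * p) := by positivity
  have hb : 0 ≤ b ^ (2 * p) := by positivity
  have h2 : (0 : ℝ) ≤ 2 ^ (2 * p) := by positivity
  rcases le_total a b with hab | hab
  · calc _ ≤ (2 * b) ^ (2 * p) := Real.rpow_le_rpow (by linarith) (by linarith) hp0
      _ = 2 ^ (2 * p) * b ^ (2 * p) := Real.mul_rpow (by norm_num) (by linarith)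
      _ ≤ _ := by gcongr; linarith
  · calc _ ≤ (2 * a) ^ (2 * p) := Real.rpow_le_rpow (by linarith) (by linarith) hp0
      _ = 2 ^ (2 * p) * a ^ (2 * p) := Real.mul_rpow (by norm_num) (by linarith)
      _ ≤ _ := by gcongr; linarith

theorem lintegral_weight_inv_lt_top {p : ℝ} (hp : 1 < p) : ∫⁻ x, (weight p x)⁻¹ < ⊤ := by
  have hfin : (Module.finrank ℝ (ℝ × ℝ) : ℝ) < 2 * p := by
    rw [Module.finrank_prod, Module.finrank_self]
    push_cast
    linarith
  refine lt_of_le_of_lt (lintegral_mono fun x => ?_)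
    (finite_integral_one_add_norm (μ := (volume : Measure (ℝ × ℝ))) hfin)
  have hx := one_le_weightBase x
  rw [weight, ← ENNReal.ofReal_inv_of_pos (by positivity), Real.rpow_neg (by positivity)]
  apply ENNReal.ofReal_le_ofReal
  have hn : ‖x‖ ≤ |x.1| + |x.2| := by
    rw [Prod.norm_def]
    simp only [Real.norm_eq_abs]
    exact max_le (by linarith [abs_nonneg x.2]) (by linarith [abs_nonneg x.1])
  exact inv_anti₀ (by positivity) (Real.rpow_le_rpow (by positivity) (by linarith) (by linarith))

theorem wnorm_sq (p : ℝ) (f : ℝ × ℝ → ℂ) :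
    wnorm p f ^ 2 = ∫⁻ x, weight p x * ‖f x‖ₑ ^ 2 := by
  rw [wnorm, ← ENNReal.rpow_natCast, ← ENNReal.rpow_mul]
  norm_num
  rfl

theorem wnorm_eq_eLpNorm (p : ℝ) {f : ℝ × ℝ → ℂ} (hf : Measurable f) :
    wnorm p f = eLpNorm f 2 (volume.withDensity (weight p)) := by
  rw [eLpNorm_eq_lintegral_rpow_enorm_toReal (by norm_num) (by norm_num),
    lintegral_withDensity_eq_lintegral_mul _ (measurable_weight p) (by fun_prop)]
  simp [wnorm, weight, enorm]

theorem wnorm_add_le (p : ℝ) {f g : ℝ × ℝ → ℂ} (hf : Measurable f) (hg : Measurable g) :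
    wnorm p (f + g) ≤ wnorm p f + wnorm p g := by
  rw [wnorm_eq_eLpNorm p hf, wnorm_eq_eLpNorm p hg, wnorm_eq_eLpNorm p (hf.add hg)]
  exact eLpNorm_add_le hf.aestronglyMeasurable hg.aestronglyMeasurable (by norm_num)

theorem wnorm_const_smul (p : ℝ) (c : ℂ) {f : ℝ × ℝ → ℂ} (hf : Measurable f) :
    wnorm p (c • f) = ‖c‖ₑ * wnorm p f := by
  rw [wnorm_eq_eLpNorm p hf, wnorm_eq_eLpNorm p (hf.const_smul c)]
  exact eLpNorm_const_smul ..

theorem wnorm_mono (p : ℝ) {f g : ℝ × ℝ → ℂ} (h : ∀ x, ‖f x‖ₑ ≤ ‖g x‖ₑ) :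
    wnorm p f ≤ wnorm p g := by
  refine (ENNReal.pow_le_pow_left_iff two_ne_zero).1 ?_
  rw [wnorm_sq, wnorm_sq]
  gcongr with x
  exact h x

theorem wnorm_dag (p : ℝ) (f : ℝ × ℝ → ℂ) : wnorm p (dag f) = wnorm p f := by
  refine (ENNReal.pow_right_strictMono two_ne_zero).injective ?_
  simp only [wnorm_sq]
  rw [← lintegral_neg_eq_self]
  simp [dag, weight_neg]

theorem wnorm_sub_le (p : ℝ) {f g : ℝ × ℝ → ℂ} (hf : Measurable f) (hg : Measurable g) :
    wnorm p (f - g) ≤ wnorm p f + wnorm p g := by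
  rw [wnorm_eq_eLpNorm p hf, wnorm_eq_eLpNorm p hg, wnorm_eq_eLpNorm p (hf.sub hg)]
  exact eLpNorm_sub_le hf.aestronglyMeasurable hg.aestronglyMeasurable (by norm_num)

theorem measurable_conv {f g : ℝ × ℝ → ℂ} (hf : Measurable f) (hg : Measurable g) :
    Measurable (conv f g) := by
  have h : StronglyMeasurable (fun z : (ℝ × ℝ) × (ℝ × ℝ) => f (z.1 - z.2) * g z.2) :=
    Measurable.stronglyMeasurable (by fun_prop)
  exact h.integral_prod_right.measurable

/-- Cauchy–Schwarz with a weight. -/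
theorem sq_lintegral_le_mul_lintegral_inv {α : Type*} [MeasurableSpace α] (μ : Measure α)
    {h u : α → ℝ≥0∞} (hh : Measurable h) (hu : Measurable u)
    (hu0 : ∀ x, u x ≠ 0) (hut : ∀ x, u x ≠ ⊤) :
    (∫⁻ x, h x ∂μ) ^ 2 ≤ (∫⁻ x, u x * h x ^ 2 ∂μ) * ∫⁻ x, (u x)⁻¹ ∂μ := by
  have key := ENNReal.lintegral_mul_le_Lp_mul_Lq μ Real.HolderConjugate.two_two
    (f := fun x => u x ^ (1 / 2 : ℝ) * h x) (g := fun x => (u x)⁻¹ ^ (1 / 2 : ℝ))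
    (by fun_prop) (by fun_prop)
  have e1 : ∀ x, ((fun x => u x ^ (1 / 2 : ℝ) * h x) * fun x => (u x)⁻¹ ^ (1 / 2 : ℝ)) x
      = h x := by
    intro x
    have h1 : u x ^ (1 / 2 : ℝ) ≠ 0 := by simp [hu0 x, hut x]
    have h2 : u x ^ (1 / 2 : ℝ) ≠ ⊤ := by simp [hu0 x, hut x]
    simp only [Pi.mul_apply, ENNReal.inv_rpow]
    rw [mul_right_comm, ENNReal.mul_inv_cancel h1 h2, one_mul]
  have e2 : ∀ x, (u x ^ (1 / 2 : ℝ) * h x) ^ (2 : ℝ) = u x * h x ^ 2 := by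
    intro x
    rw [ENNReal.mul_rpow_of_nonneg _ _ (by norm_num), ← ENNReal.rpow_mul]
    norm_num
  have e3 : ∀ x, ((u x)⁻¹ ^ (1 / 2 : ℝ)) ^ (2 : ℝ) = (u x)⁻¹ := by
    intro x
    rw [← ENNReal.rpow_mul]
    norm_num
  simp only [e1, e2, e3] at key
  refine (pow_le_pow_left' key 2).trans_eq ?_
  rw [mul_pow, ← ENNReal.rpow_natCast, ← ENNReal.rpow_natCast, ← ENNReal.rpow_mul,
    ← ENNReal.rpow_mul]
  norm_num

/-- The constant in the algebra property of the weighted space. -/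
noncomputable def convConst (p : ℝ) : ℝ≥0∞ :=
  ENNReal.ofReal (2 ^ (2 * p)) * (2 * ∫⁻ x, (weight p x)⁻¹)

theorem convConst_lt_top {p : ℝ} (hp : 1 < p) : convConst p < ⊤ :=
  ENNReal.mul_lt_top ENNReal.ofReal_lt_top
    (ENNReal.mul_lt_top (by norm_num) (lintegral_weight_inv_lt_top hp))

theorem weight_mul_lintegral_inv_le {p : ℝ} (hp : 1 < p) (ξ : ℝ × ℝ) :
    weight p ξ * ∫⁻ η, (weight p (ξ - η) * weight p η)⁻¹ ≤ convConst p := by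
  have hm := measurable_weight p
  have h0 : ∀ x, weight p x ≠ 0 := fun x => (zero_lt_one.trans_le (one_le_weight hp x)).ne'
  rw [← lintegral_const_mul _ (by fun_prop)]
  calc _ ≤ ∫⁻ η, ENNReal.ofReal (2 ^ (2 * p)) * ((weight p η)⁻¹ + (weight p (ξ - η))⁻¹) := by
        refine lintegral_mono fun η => ?_
        have h := weight_add_le hp (ξ - η) η
        rw [sub_add_cancel] at h
        refine (mul_le_mul_left h _).trans_eq ?_
        rw [ENNReal.mul_inv (Or.inl (h0 _)) (Or.inr (h0 _)), mul_assoc, add_mul]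
        congr 2
        · rw [← mul_assoc, ENNReal.mul_inv_cancel (h0 _) (weight_ne_top _ _), one_mul]
        · rw [mul_left_comm, ENNReal.mul_inv_cancel (h0 _) (weight_ne_top _ _), mul_one]
    _ = convConst p := by
        rw [lintegral_const_mul _ (by fun_prop), lintegral_add_left (by fun_prop),
          lintegral_sub_left_eq_self (fun x => (weight p x)⁻¹) ξ, convConst,
          two_mul (∫⁻ x, (weight p x)⁻¹)]

/-- The weighted space is an algebra under convolution. -/
theorem wnorm_conv_sq_le {p : ℝ} (hp : 1 < p) {f g : ℝ × ℝ → ℂ} (hf : Measurable f)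
    (hg : Measurable g) :
    wnorm p (conv f g) ^ 2 ≤ convConst p * (wnorm p f ^ 2 * wnorm p g ^ 2) := by
  have hm := measurable_weight p
  have h0 : ∀ x, weight p x ≠ 0 := fun x => (zero_lt_one.trans_le (one_le_weight hp x)).ne'
  rw [wnorm_sq]
  calc ∫⁻ ξ, weight p ξ * ‖conv f g ξ‖ₑ ^ 2
      ≤ ∫⁻ ξ, convConst p * ∫⁻ η, (weight p (ξ - η) * ‖f (ξ - η)‖ₑ ^ 2) *
          (weight p η * ‖g η‖ₑ ^ 2) := by
        refine lintegral_mono fun ξ => ?_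
        have h1 : ‖conv f g ξ‖ₑ ≤ ∫⁻ η, ‖f (ξ - η)‖ₑ * ‖g η‖ₑ := by
          refine (enorm_integral_le_lintegral_enorm _).trans_eq ?_
          simp
        have h2 := sq_lintegral_le_mul_lintegral_inv volume
          (h := fun η => ‖f (ξ - η)‖ₑ * ‖g η‖ₑ) (u := fun η => weight p (ξ - η) * weight p η)
          (by fun_prop) (by fun_prop) (fun x => mul_ne_zero (h0 _) (h0 _))
          (fun x => ENNReal.mul_ne_top (weight_ne_top _ _) (weight_ne_top _ _))
        calc weight p ξ * ‖conv f g ξ‖ₑ ^ 2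
            ≤ weight p ξ * ((∫⁻ η, weight p (ξ - η) * weight p η *
                (‖f (ξ - η)‖ₑ * ‖g η‖ₑ) ^ 2) *
                ∫⁻ η, (weight p (ξ - η) * weight p η)⁻¹) := by
              gcongr
              exact (pow_le_pow_left' h1 2).trans h2
          _ = (weight p ξ * ∫⁻ η, (weight p (ξ - η) * weight p η)⁻¹) *
                ∫⁻ η, weight p (ξ - η) * weight p η * (‖f (ξ - η)‖ₑ * ‖g η‖ₑ) ^ 2 := by ring
          _ ≤ convConst p *
                ∫⁻ η, weight p (ξ - η) * weight p η * (‖f (ξ - η)‖ₑ * ‖g η‖ₑ) ^ 2 := by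
              gcongr
              exact weight_mul_lintegral_inv_le hp ξ
          _ = _ := by
              congr 2
              ext η
              ring
    _ = convConst p * (wnorm p f ^ 2 * wnorm p g ^ 2) := by
        rw [lintegral_const_mul' _ _ (convConst_lt_top hp).ne,
          lintegral_lintegral_swap (by fun_prop)]
        congr 1
        simp_rw [wnorm_sq]
        rw [← lintegral_const_mul _ (by fun_prop)]
        refine lintegral_congr fun η => ?_
        rw [lintegral_mul_const _ (by fun_prop),
          lintegral_sub_right_eq_self (fun x => weight p x * ‖f x‖ₑ ^ 2) η]

theorem wnorm_conv_le {p : ℝ} (hp : 1 < p) {f g : ℝ × ℝ → ℂ} (hf : Measurable f)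
    (hg : Measurable g) :
    wnorm p (conv f g) ≤ convConst p ^ (1 / 2 : ℝ) * (wnorm p f * wnorm p g) := by
  refine (ENNReal.pow_le_pow_left_iff two_ne_zero).1 ((wnorm_conv_sq_le hp hf hg).trans_eq ?_)
  rw [mul_pow, mul_pow, ← ENNReal.rpow_natCast (convConst p ^ (1 / 2 : ℝ)), ← ENNReal.rpow_mul]
  norm_num

theorem FiniteWnorm.memLp {p : ℝ} (hp : 1 < p) {f : ℝ × ℝ → ℂ} (hf : FiniteWnorm p f) :
    MemLp f 2 := by
  refine ⟨hf.1.aestronglyMeasurable, lt_of_le_of_lt ?_ hf.2⟩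
  rw [eLpNorm_eq_lintegral_rpow_enorm_toReal (by norm_num) (by norm_num), wnorm]
  simp only [ENNReal.toReal_ofNat, ENNReal.rpow_ofNat]
  gcongr with x
  exact le_mul_of_one_le_left' (one_le_weight hp x)

theorem FiniteWnorm.integrable_conv {p : ℝ} (hp : 1 < p) {f g : ℝ × ℝ → ℂ}
    (hf : FiniteWnorm p f) (hg : FiniteWnorm p g) (ξ : ℝ × ℝ) :
    Integrable (fun η => f (ξ - η) * g η) :=
  ((hf.memLp hp).comp_measurePreserving
    (Measure.measurePreserving_sub_left volume ξ)).integrable_mul (hg.memLp hp)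

theorem FiniteWnorm.conv {p : ℝ} (hp : 1 < p) {f g : ℝ × ℝ → ℂ}
    (hf : FiniteWnorm p f) (hg : FiniteWnorm p g) : FiniteWnorm p (conv f g) :=
  ⟨measurable_conv hf.1 hg.1, (wnorm_conv_le hp hf.1 hg.1).trans_lt
    (ENNReal.mul_lt_top (ENNReal.rpow_lt_top_of_nonneg (by norm_num) (convConst_lt_top hp).ne)
      (ENNReal.mul_lt_top hf.2 hg.2))⟩

theorem FiniteWnorm.sub {p : ℝ} {f g : ℝ × ℝ → ℂ} (hf : FiniteWnorm p f)
    (hg : FiniteWnorm p g) : FiniteWnorm p (f - g) :=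
  ⟨hf.1.sub hg.1, (wnorm_sub_le p hf.1 hg.1).trans_lt (ENNReal.add_lt_top.2 ⟨hf.2, hg.2⟩)⟩

theorem FiniteWnorm.dag {p : ℝ} {f : ℝ × ℝ → ℂ} (hf : FiniteWnorm p f) :
    FiniteWnorm p (dag f) := by
  refine ⟨?_, (wnorm_dag p f).trans_lt hf.2⟩
  have := hf.1
  unfold _root_.dag
  exact Complex.continuous_conj.measurable.comp (this.comp measurable_neg)

/-- Multiplication by the symbol `σ`. -/
noncomputable def sigmaApply (f : ℝ × ℝ → ℂ) : ℝ × ℝ → ℂ := fun η => (sigmaMul η : ℂ) * f η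

theorem measurable_sigmaMul : Measurable sigmaMul :=
  Measurable.ite (measurableSet_singleton 0) measurable_const (by fun_prop)

theorem abs_sigmaMul_le_one (x : ℝ × ℝ) : |sigmaMul x| ≤ 1 := by
  unfold sigmaMul
  split_ifs
  · simp
  · rw [abs_of_nonneg (by positivity)]
    exact div_le_one_of_le₀ (by linarith [sq_nonneg x.2]) (by positivity)

theorem wnorm_sigmaApply_le (p : ℝ) (f : ℝ × ℝ → ℂ) : wnorm p (sigmaApply f) ≤ wnorm p f := by
  refine wnorm_mono p fun x => ?_
  rw [enorm_le_iff_norm_le, sigmaApply, norm_mul, Complex.norm_real, Real.norm_eq_abs]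
  exact mul_le_of_le_one_left (norm_nonneg _) (abs_sigmaMul_le_one x)

theorem FiniteWnorm.sigmaApply {p : ℝ} {f : ℝ × ℝ → ℂ} (hf : FiniteWnorm p f) :
    FiniteWnorm p (sigmaApply f) := by
  refine ⟨?_, (wnorm_sigmaApply_le p f).trans_lt hf.2⟩
  have h1 := hf.1
  have h2 := measurable_sigmaMul
  unfold _root_.sigmaApply
  fun_prop

theorem dag_sub (f g : ℝ × ℝ → ℂ) : dag (f - g) = dag f - dag g := by
  ext x
  simp [dag]

theorem sigmaApply_sub (f g : ℝ × ℝ → ℂ) :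
    sigmaApply (f - g) = sigmaApply f - sigmaApply g := by
  ext x
  simp [sigmaApply, mul_sub]

/-- The difference of two convolutions, expanded bilinearly. -/
theorem conv_sub_conv {p : ℝ} (hp : 1 < p) {f₁ f₂ g₁ g₂ : ℝ × ℝ → ℂ} (hf₁ : FiniteWnorm p f₁)
    (hf₂ : FiniteWnorm p f₂) (hg₁ : FiniteWnorm p g₁) (hg₂ : FiniteWnorm p g₂) :
    conv f₁ g₁ - conv f₂ g₂ = conv (f₁ - f₂) g₁ + conv f₂ (g₁ - g₂) := by
  ext ξ
  rw [Pi.sub_apply, Pi.add_apply]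
  unfold conv
  rw [← integral_sub (hf₁.integrable_conv hp hg₁ ξ) (hf₂.integrable_conv hp hg₂ ξ),
    ← integral_add ((hf₁.sub hf₂).integrable_conv hp hg₁ ξ)
      (hf₂.integrable_conv hp (hg₁.sub hg₂) ξ)]
  congr 1
  ext η
  simp only [Pi.sub_apply]
  ring

theorem wnorm_conv_sub_conv_le {p : ℝ} (hp : 1 < p) {f₁ f₂ g₁ g₂ : ℝ × ℝ → ℂ}
    (hf₁ : FiniteWnorm p f₁) (hf₂ : FiniteWnorm p f₂) (hg₁ : FiniteWnorm p g₁)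
    (hg₂ : FiniteWnorm p g₂) :
    wnorm p (conv f₁ g₁ - conv f₂ g₂) ≤ convConst p ^ (1 / 2 : ℝ) *
      (wnorm p (f₁ - f₂) * wnorm p g₁ + wnorm p f₂ * wnorm p (g₁ - g₂)) := by
  rw [conv_sub_conv hp hf₁ hf₂ hg₁ hg₂, mul_add]
  exact (wnorm_add_le p (measurable_conv (hf₁.sub hf₂).1 hg₁.1)
    (measurable_conv hf₂.1 (hg₁.sub hg₂).1)).trans
    (add_le_add (wnorm_conv_le hp (hf₁.sub hf₂).1 hg₁.1)
      (wnorm_conv_le hp hf₂.1 (hg₁.sub hg₂).1))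

theorem Lop_eq (γ lam μ : ℝ) (v : ℝ × ℝ → ℂ) :
    Lop γ lam μ v = (γ : ℂ) • conv (conv v (dag v)) v +
      ((lam * μ : ℝ) : ℂ) • conv v (sigmaApply (conv v (dag v))) := rfl

/-- **The Davey–Stewartson nonlinearity is Lipschitz on bounded sets.** For `p > 1`
there is a constant `C > 0` depending only on `p` such that for all measurable `v, w`
with finite weighted norms,
`‖L(v) - L(w)‖_p ≤ C (|γ| + |λμ|) (‖v‖_p + ‖w‖_p)² ‖v - w‖_p`. -/
theorem Lop_lipschitz (p : ℝ) (hp : 1 < p) :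
    ∃ C : ℝ≥0∞, 0 < C ∧ C < ⊤ ∧
      ∀ (γ lam μ : ℝ) (v w : ℝ × ℝ → ℂ), Measurable v → Measurable w →
        wnorm p v < ⊤ → wnorm p w < ⊤ →
        wnorm p (Lop γ lam μ v - Lop γ lam μ w) ≤
          C * ENNReal.ofReal (|γ| + |lam * μ|) * (wnorm p v + wnorm p w) ^ 2 *
            wnorm p (v - w) := by
  set K := convConst p ^ (1 / 2 : ℝ)
  have hKt : K < ⊤ := ENNReal.rpow_lt_top_of_nonneg (by norm_num) (convConst_lt_top hp).ne
  refine ⟨K ^ 2 + 1, by positivity, ENNReal.add_lt_top.2 ⟨ENNReal.pow_lt_top hKt, by norm_num⟩, ?_⟩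
  intro γ lam μ v w hvm hwm hvt hwt
  have hv : FiniteWnorm p v := ⟨hvm, hvt⟩
  have hw : FiniteWnorm p w := ⟨hwm, hwt⟩
  have hBv := hv.conv hp hv.dag
  have hBw := hw.conv hp hw.dag
  set Bv := conv v (dag v)
  set Bw := conv w (dag w)
  set a := wnorm p v
  set b := wnorm p w
  set d := wnorm p (v - w)
  have hD : wnorm p (Bv - Bw) ≤ K * (d * a + b * d) := by
    have h := wnorm_conv_sub_conv_le hp hv hw hv.dag hw.dag
    rwa [← dag_sub, wnorm_dag, wnorm_dag] at h
  have hBv_le : wnorm p Bv ≤ K * (a * a) := by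
    have h := wnorm_conv_le hp hv.1 hv.dag.1
    rwa [wnorm_dag] at h
  have hBw_le : wnorm p Bw ≤ K * (b * b) := by
    have h := wnorm_conv_le hp hw.1 hw.dag.1
    rwa [wnorm_dag] at h
  have hsum : d * (a * a) + b * (d * a + b * d) ≤ (a + b) ^ 2 * d := by
    calc d * (a * a) + b * (d * a + b * d)
        ≤ d * (a * a) + b * (d * a + b * d) + a * b * d := le_self_add
      _ = (a + b) ^ 2 * d := by ring
  have hcubic : wnorm p (conv Bv v - conv Bw w) ≤ K ^ 2 * ((a + b) ^ 2 * d) := by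
    calc _ ≤ K * (wnorm p (Bv - Bw) * a + wnorm p Bw * d) :=
          wnorm_conv_sub_conv_le hp hBv hBw hv hw
      _ ≤ K * (K * (d * a + b * d) * a + K * (b * b) * d) := by gcongr
      _ = K ^ 2 * (d * (a * a) + b * (d * a + b * d)) := by ring
      _ ≤ _ := by gcongr
  have hnonlocal : wnorm p (conv v (sigmaApply Bv) - conv w (sigmaApply Bw)) ≤
      K ^ 2 * ((a + b) ^ 2 * d) := by
    calc _ ≤ K * (d * wnorm p (sigmaApply Bv) + b * wnorm p (sigmaApply Bv - sigmaApply Bw)) :=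
          wnorm_conv_sub_conv_le hp hv hw hBv.sigmaApply hBw.sigmaApply
      _ ≤ K * (d * (K * (a * a)) + b * (K * (d * a + b * d))) := by
          rw [← sigmaApply_sub]
          gcongr
          · exact (wnorm_sigmaApply_le p _).trans hBv_le
          · exact (wnorm_sigmaApply_le p _).trans hD
      _ = K ^ 2 * (d * (a * a) + b * (d * a + b * d)) := by ring
      _ ≤ _ := by gcongr
  have hm₁ : Measurable (conv Bv v - conv Bw w) := ((hBv.conv hp hv).sub (hBw.conv hp hw)).1
  have hm₂ : Measurable (conv v (sigmaApply Bv) - conv w (sigmaApply Bw)) :=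
    ((hv.conv hp hBv.sigmaApply).sub (hw.conv hp hBw.sigmaApply)).1
  have hL : Lop γ lam μ v - Lop γ lam μ w = (γ : ℂ) • (conv Bv v - conv Bw w) +
      ((lam * μ : ℝ) : ℂ) • (conv v (sigmaApply Bv) - conv w (sigmaApply Bw)) := by
    rw [Lop_eq, Lop_eq, smul_sub, smul_sub]
    abel
  have henorm : ∀ r : ℝ, ‖(r : ℂ)‖ₑ = ENNReal.ofReal |r| := fun r => by
    rw [← ofReal_norm, Complex.norm_real, Real.norm_eq_abs]
  calc wnorm p (Lop γ lam μ v - Lop γ lam μ w)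
      ≤ ENNReal.ofReal |γ| * (K ^ 2 * ((a + b) ^ 2 * d)) +
          ENNReal.ofReal |lam * μ| * (K ^ 2 * ((a + b) ^ 2 * d)) := by
        rw [hL]
        refine (wnorm_add_le p (hm₁.const_smul _) (hm₂.const_smul _)).trans ?_
        rw [wnorm_const_smul p _ hm₁, wnorm_const_smul p _ hm₂, henorm, henorm]
        gcongr
    _ = K ^ 2 * ENNReal.ofReal (|γ| + |lam * μ|) * (a + b) ^ 2 * d := by
        rw [ENNReal.ofReal_add (abs_nonneg _) (abs_nonneg _)]
        ring
    _ ≤ (K ^ 2 + 1) * ENNReal.ofReal (|γ| + |lam * μ|) * (a + b) ^ 2 * d := by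
        gcongr
        exact le_self_add
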